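/- arXiv:2102.10804 — 4 statements merged into one kernel-verified Lean document; each statement's English description precedes it below -/
import Mathlib

section
/- Let n be a positive integer with 5 ∤ n. Then the sum over all integers j ≥ 0 of σ(2n+1 − j(j+1)) is congruent to 0 modulo 5 (the sum is finite since σ vanishes on non-positive arguments). -/
/-- Sum of divisors of an integer, with `sigmaZ m = 0` when `m` is not a positive integer. -/
def sigmaZ (m : ℤ) : ℤ := ∑ d ∈ m.toNat.divisors, (d : ℤ)

/-- Triples `(s, d, e)` with `s ^ 2 + 4 * d * e = N` and `d, e > 0`. -/
noncomputable def windT (N : ℤ) : Finset (ℤ × ℤ × ℤ) :=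
  ((Finset.Icc (-N) N) ×ˢ (Finset.Icc 1 N) ×ˢ (Finset.Icc 1 N)).filter
    (fun x => x.1 ^ 2 + 4 * (x.2.1 * x.2.2) = N)

theorem mem_windT (N s d e : ℤ) :
    (s, d, e) ∈ windT N ↔ 0 < d ∧ 0 < e ∧ s ^ 2 + 4 * (d * e) = N := by
  simp only [windT, Finset.mem_filter, Finset.mem_product, Finset.mem_Icc]
  constructor
  · rintro ⟨⟨_, ⟨h1, _⟩, h2, _⟩, h⟩
    exact ⟨by omega, by omega, h⟩
  · rintro ⟨hd, he, h⟩
    have h1 : d ≤ d * e := by nlinarith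
    have h2 : e ≤ d * e := by nlinarith
    have h3 : s ≤ s ^ 2 := Int.le_self_sq s
    have h4 : -s ≤ s ^ 2 := by have := Int.le_self_sq (-s); nlinarith
    have h5 : 0 ≤ s ^ 2 := sq_nonneg s
    refine ⟨⟨⟨by omega, by omega⟩, ⟨by omega, by omega⟩, by omega, by omega⟩, h⟩

/-- Sum is invariant under negation of `s`. -/
theorem windT_neg (N : ℤ) (f : ℤ × ℤ × ℤ → ℤ) :
    ∑ x ∈ windT N, f x = ∑ x ∈ windT N, f (-x.1, x.2.1, x.2.2) := by
  refine Finset.sum_nbij' (fun x => (-x.1, x.2.1, x.2.2)) (fun x => (-x.1, x.2.1, x.2.2))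
    ?_ ?_ ?_ ?_ ?_
  all_goals rintro ⟨s, d, e⟩ h
  · rw [mem_windT] at *; simpa using h
  · rw [mem_windT] at *; simpa using h
  all_goals simp

theorem not_sq (n k : ℤ) : k ^ 2 ≠ 8 * n + 5 := by
  intro h
  have h2 : (k ^ 2) % 8 = 5 := by omega
  have : k % 8 = 0 ∨ k % 8 = 1 ∨ k % 8 = 2 ∨ k % 8 = 3 ∨ k % 8 = 4 ∨ k % 8 = 5 ∨
    k % 8 = 6 ∨ k % 8 = 7 := by omega
  rcases this with h | h | h | h | h | h | h | h <;> simp [pow_two, Int.mul_emod, h] at h2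

theorem windT_main (n : ℤ) :
    ∑ x ∈ windT (8 * n + 5), (x.2.1 * x.2.2 - x.1 ^ 2) * x.2.1 = 0 := by
  set T := windT (8 * n + 5) with hT
  have h0 : ∑ x ∈ T, x.1 * x.2.1 ^ 2 = 0 := by
    have h := windT_neg (8 * n + 5) (fun x => x.1 * x.2.1 ^ 2)
    simp only [neg_mul, Finset.sum_neg_distrib] at h
    rw [← hT] at h
    omega
  have h1 : ∑ x ∈ T, (x.2.1 * x.2.2 - x.1 ^ 2) * x.2.1
      = ∑ x ∈ T, ((x.2.1 * x.2.2 - x.1 ^ 2) * x.2.1 - x.1 * x.2.1 ^ 2) := by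
    rw [Finset.sum_sub_distrib, h0, sub_zero]
  rw [h1, ← Finset.sum_filter_add_sum_filter_not T (fun x => x.1 + x.2.1 < x.2.2)]
  have h2 : ∑ x ∈ T.filter (fun x => ¬ (x.1 + x.2.1 < x.2.2)),
        ((x.2.1 * x.2.2 - x.1 ^ 2) * x.2.1 - x.1 * x.2.1 ^ 2)
      = ∑ x ∈ T.filter (fun x => x.1 + x.2.1 < x.2.2),
        ((x.2.1 * x.2.2 - x.1 ^ 2) * x.2.2 + x.1 * x.2.2 ^ 2) := by
    refine Finset.sum_nbij' (fun x => (-x.1, x.2.2, x.2.1)) (fun x => (-x.1, x.2.2, x.2.1))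
      ?_ ?_ ?_ ?_ ?_
    · rintro ⟨s, d, e⟩ h
      simp only [Finset.mem_filter, hT, mem_windT] at h ⊢
      obtain ⟨⟨hd, he, h⟩, h'⟩ := h
      refine ⟨⟨he, hd, by linarith⟩, ?_⟩
      have : e ≠ s + d := by
        rintro rfl
        exact not_sq n (s + 2 * d) (by linarith)
      omega
    · rintro ⟨s, d, e⟩ h
      simp only [Finset.mem_filter, hT, mem_windT] at h ⊢
      obtain ⟨⟨hd, he, h⟩, h'⟩ := h
      exact ⟨⟨he, hd, by linarith⟩, by omega⟩
    · rintro ⟨s, d, e⟩ h; simp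
    · rintro ⟨s, d, e⟩ h; simp
    · rintro ⟨s, d, e⟩ h; simp only; ring
  rw [h2, ← Finset.sum_add_distrib]
  have h3 : ∑ x ∈ T.filter (fun x => x.1 + x.2.1 < x.2.2),
        (((x.2.1 * x.2.2 - x.1 ^ 2) * x.2.1 - x.1 * x.2.1 ^ 2) +
        ((x.2.1 * x.2.2 - x.1 ^ 2) * x.2.2 + x.1 * x.2.2 ^ 2))
      = ∑ x ∈ T.filter (fun x => x.1 + x.2.1 < x.2.2),
        -(((x.2.1 * x.2.2 - x.1 ^ 2) * x.2.1 - x.1 * x.2.1 ^ 2) +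
        ((x.2.1 * x.2.2 - x.1 ^ 2) * x.2.2 + x.1 * x.2.2 ^ 2)) := by
    have key : ∀ x ∈ T.filter (fun x => x.1 + x.2.1 < x.2.2),
        ((-x.1 - 2 * x.2.1, x.2.1, x.2.2 - x.1 - x.2.1) : ℤ × ℤ × ℤ) ∈
          T.filter (fun x => x.1 + x.2.1 < x.2.2) := by
      rintro ⟨s, d, e⟩ h
      simp only [Finset.mem_filter, hT, mem_windT] at h ⊢
      obtain ⟨⟨hd, he, h⟩, h'⟩ := h
      exact ⟨⟨hd, by omega, by linarith⟩, by omega⟩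
    refine Finset.sum_nbij' (fun x => (-x.1 - 2 * x.2.1, x.2.1, x.2.2 - x.1 - x.2.1))
      (fun x => (-x.1 - 2 * x.2.1, x.2.1, x.2.2 - x.1 - x.2.1)) key key ?_ ?_ ?_
    · rintro ⟨s, d, e⟩ h; ext <;> simp only <;> ring
    · rintro ⟨s, d, e⟩ h; ext <;> simp only <;> ring
    · rintro ⟨s, d, e⟩ h; simp only; ring
  rw [Finset.sum_neg_distrib] at h3
  omega

theorem windT_dvd (n : ℕ) (h5 : ¬ (5 ∣ n)) :
    (5 : ℤ) ∣ ∑ x ∈ windT (8 * (n : ℤ) + 5), x.2.1 := by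
  have h := windT_main n
  have h1 : ∑ x ∈ windT (8 * (n : ℤ) + 5), (x.2.1 * x.2.2 - x.1 ^ 2) * x.2.1
      = 5 * ∑ x ∈ windT (8 * (n : ℤ) + 5), (x.2.1 * x.2.2 - 1) * x.2.1
        - 8 * n * ∑ x ∈ windT (8 * (n : ℤ) + 5), x.2.1 := by
    rw [Finset.mul_sum, Finset.mul_sum, ← Finset.sum_sub_distrib]
    refine Finset.sum_congr rfl ?_
    rintro ⟨s, d, e⟩ h
    rw [mem_windT] at h
    have : s ^ 2 = 8 * n + 5 - 4 * (d * e) := by linarith [h.2.2]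
    simp only [this]; ring
  rw [h] at h1
  have h2 : (5 : ℤ) ∣ (8 * n) * ∑ x ∈ windT (8 * (n : ℤ) + 5), x.2.1 :=
    ⟨∑ x ∈ windT (8 * (n : ℤ) + 5), (x.2.1 * x.2.2 - 1) * x.2.1, by linarith⟩
  rcases (Int.prime_iff_natAbs_prime.mpr (by norm_num) : Prime (5 : ℤ)).dvd_or_dvd h2 with h | h
  · exact absurd h (by omega)
  · exact h

theorem windT_pos (n : ℤ) :
    ∑ x ∈ windT (8 * n + 5), x.2.1
      = 2 * ∑ x ∈ (windT (8 * n + 5)).filter (fun x => 0 < x.1), x.2.1 := by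
  rw [← Finset.sum_filter_add_sum_filter_not _ (fun x : ℤ × ℤ × ℤ => 0 < x.1), two_mul]
  congr 1
  refine Finset.sum_nbij' (fun x => (-x.1, x.2.1, x.2.2)) (fun x => (-x.1, x.2.1, x.2.2))
    ?_ ?_ ?_ ?_ ?_
  all_goals rintro ⟨s, d, e⟩ h
  · simp only [Finset.mem_filter, mem_windT] at h ⊢
    obtain ⟨⟨hd, he, h⟩, h'⟩ := h
    refine ⟨⟨hd, he, by linarith⟩, ?_⟩
    have : s ≠ 0 := by rintro rfl; omega
    omega
  · simp only [Finset.mem_filter, mem_windT] at h ⊢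
    obtain ⟨⟨hd, he, h⟩, h'⟩ := h
    exact ⟨⟨hd, he, by linarith⟩, by omega⟩
  all_goals simp

theorem windT_sigma (n : ℕ) :
    ∑ x ∈ (windT (8 * (n : ℤ) + 5)).filter (fun x => 0 < x.1), x.2.1
      = ∑ j ∈ Finset.range (2 * n + 2),
        sigmaZ (2 * (n : ℤ) + 1 - (j : ℤ) * ((j : ℤ) + 1)) := by
  have hodd : ∀ s d e : ℤ, s ^ 2 + 4 * (d * e) = 8 * n + 5 → s % 2 = 1 := by
    intro s d e h
    rcases Int.emod_two_eq_zero_or_one s with h0 | h0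
    · have : (s ^ 2) % 2 = 0 := by simp [pow_two, Int.mul_emod, h0]
      omega
    · exact h0
  rw [← Finset.sum_fiberwise_of_maps_to (t := Finset.range (2 * n + 2))
    (g := fun x : ℤ × ℤ × ℤ => (x.1 / 2).toNat)]
  · refine Finset.sum_congr rfl ?_
    intro j _
    unfold sigmaZ
    refine Finset.sum_bij' (fun x _ => x.2.1.toNat)
      (fun k _ => (2 * (j : ℤ) + 1, (k : ℤ),
        (2 * (n : ℤ) + 1 - (j : ℤ) * ((j : ℤ) + 1)) / k)) ?_ ?_ ?_ ?_ ?_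
    · rintro ⟨s, d, e⟩ h
      simp only [Finset.mem_filter, mem_windT] at h
      obtain ⟨⟨⟨hd, he, h⟩, hs⟩, hj⟩ := h
      have := hodd s d e h
      obtain rfl : s = 2 * j + 1 := by omega
      have hm : 2 * (n : ℤ) + 1 - j * (j + 1) = d * e := by linarith
      have hp : 0 < d * e := mul_pos hd he
      rw [hm, Nat.mem_divisors]
      refine ⟨?_, by omega⟩
      rw [Int.toNat_mul hd.le he.le]
      exact dvd_mul_right _ _
    · intro k hk
      rw [Nat.mem_divisors] at hk
      obtain ⟨⟨c, hc⟩, hk0⟩ := hk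
      have hm : 2 * (n : ℤ) + 1 - j * (j + 1) = k * c := by
        have : ((2 * (n : ℤ) + 1 - j * (j + 1)).toNat : ℤ) = k * c := by rw [hc]; push_cast; rfl
        omega
      rw [hc] at hk0
      have hk1 : 0 < k := Nat.pos_of_ne_zero (left_ne_zero_of_mul hk0)
      have hc1 : 0 < c := Nat.pos_of_ne_zero (right_ne_zero_of_mul hk0)
      have hq : (2 * (n : ℤ) + 1 - j * (j + 1)) / k = c := by
        rw [hm]; exact Int.mul_ediv_cancel_left _ (by omega)
      simp only [Finset.mem_filter, mem_windT, hq]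
      exact ⟨⟨⟨by omega, by omega, by linarith⟩, by omega⟩, by omega⟩
    · rintro ⟨s, d, e⟩ h
      simp only [Finset.mem_filter, mem_windT] at h
      obtain ⟨⟨⟨hd, he, h⟩, hs⟩, hj⟩ := h
      have := hodd s d e h
      obtain rfl : s = 2 * j + 1 := by omega
      have hm : 2 * (n : ℤ) + 1 - j * (j + 1) = d * e := by linarith
      simp only [hm, Int.toNat_of_nonneg hd.le, Int.mul_ediv_cancel_left e hd.ne']
    · intro k hk
      simp
    · rintro ⟨s, d, e⟩ h
      simp only [Finset.mem_filter, mem_windT] at h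
      simp only [Int.toNat_of_nonneg h.1.1.1.le]
  · rintro ⟨s, d, e⟩ h
    simp only [Finset.mem_filter, mem_windT] at h
    obtain ⟨⟨hd, he, h⟩, hs⟩ := h
    have hp : 0 < d * e := mul_pos hd he
    simp only [Finset.mem_range]
    have : s < 4 * n + 4 := by nlinarith
    omega

theorem sum_sigma_triangular_shift_mod_five (n : ℕ) (hn : 0 < n) (h5 : ¬ (5 ∣ n)) :
    (5 : ℤ) ∣ ∑ᶠ j : ℕ, sigmaZ (2 * (n : ℤ) + 1 - (j : ℤ) * ((j : ℤ) + 1)) := by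
  rw [finsum_eq_sum_of_support_subset (s := Finset.range (2 * n + 2))]
  · rw [← windT_sigma]
    have h := windT_dvd n h5
    rw [windT_pos] at h
    omega
  · intro j hj
    by_contra hlt
    apply hj
    simp only [Finset.coe_range, Set.mem_Iio, not_lt] at hlt
    have h1 : (2 * (n : ℤ) + 2) ≤ j := by exact_mod_cast hlt
    have h2 : 2 * (n : ℤ) + 1 - (j : ℤ) * ((j : ℤ) + 1) ≤ 0 := by nlinarith
    simp [sigmaZ, Int.toNat_of_nonpos h2]
end

section
/- Let n be a positive integer that is not a triangular number, i.e., n ≠ k(k+1)/2 for every integer k. Then the sum over all integers j ≥ 0 of σ(n − j(j+1)/2) is congruent to 0 modulo 4 (the sum is finite since σ vanishes on non-positive arguments). -/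
open PowerSeries in
theorem aux_shanks_partial {R : Type*} [CommRing R] (q : R) (D : ℕ → R) (E : ℕ → ℕ → R)
    (hD : ∀ s, D (s+1) = D s * (1 - q^(2*s+1)))
    (hE1 : ∀ s n, s ≤ n → E s (n+1) = E s n * (1 - q^(2*n+2)))
    (hE2 : ∀ s n, s < n → E s n = (1 - q^(2*s+2)) * E (s+1) n)
    (n m : ℕ) (hm : m ≤ n) :
    ∑ s ∈ Finset.range m, D s * E s (n+1) * q^(s*(2*n+3)) =
      (1 - q^(2*n+1)) * ∑ s ∈ Finset.range m, D s * E s n * q^(s*(2*n+1))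
      + D m * (1 - q^(2*m)) * E m n * q^(m*(2*n+1)) := by
  induction m with
  | zero => simp
  | succ m ih =>
    rw [Finset.sum_range_succ, Finset.sum_range_succ, ih (by omega), hE1 m n (by omega),
      hD m, hE2 m n (by omega)]
    ring

theorem aux_shanks {R : Type*} [CommRing R] (q : R) (D : ℕ → R) (E : ℕ → ℕ → R)
    (hD : ∀ s, D (s+1) = D s * (1 - q^(2*s+1))) (hE0 : ∀ n, E n n = 1)
    (hE1 : ∀ s n, s ≤ n → E s (n+1) = E s n * (1 - q^(2*n+2)))
    (hE2 : ∀ s n, s < n → E s n = (1 - q^(2*s+2)) * E (s+1) n)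
    (n : ℕ) :
    D n * ∑ s ∈ Finset.range (2*n), q^(s*(s+1)/2) =
      ∑ s ∈ Finset.range n, D s * E s n * q^(s*(2*n+1)) := by
  induction n with
  | zero => simp
  | succ n ih =>
    have h1 : 2 * n * (2 * n + 1) / 2 = n * (2*n+1) := by
      rw [mul_assoc]; exact Nat.mul_div_cancel_left _ (by norm_num)
    have h2 : (2 * n + 1) * (2 * n + 1 + 1) / 2 = (n+1) * (2*n+1) := by
      rw [show (2 * n + 1) * (2 * n + 1 + 1) = 2 * ((n+1) * (2*n+1)) by ring]
      exact Nat.mul_div_cancel_left _ (by norm_num)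
    have h3 := aux_shanks_partial q D E hD hE1 hE2 n n le_rfl
    rw [show 2 * (n+1) = 2*n+1+1 by ring, Finset.sum_range_succ, Finset.sum_range_succ, h1, h2,
      Finset.sum_range_succ, show 2*n+1+1+1 = 2*n+3 by ring, h3, ← ih, hE1 n n le_rfl, hE0, hD]
    ring

open PowerSeries in
theorem aux_logderiv {R : Type*} [CommRing R] (f g : ℕ → R⟦X⟧)
    (h : ∀ k, X * d⁄dX R (f k) = - (f k * g k)) (n : ℕ) :
    X * d⁄dX R (∏ k ∈ Finset.range n, f k) =
      - ((∏ k ∈ Finset.range n, f k) * ∑ k ∈ Finset.range n, g k) := by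
  induction n with
  | zero => simp
  | succ n ih =>
    rw [Finset.prod_range_succ, Finset.sum_range_succ, Derivation.leibniz, smul_eq_mul,
      smul_eq_mul]
    linear_combination (∏ k ∈ Finset.range n, f k) * h n + f n * ih

/-- Lambert series `k q^k / (1 - q^k)`. -/
noncomputable def auxL (R : Type*) [CommRing R] (k : ℕ) : PowerSeries R :=
  PowerSeries.mk fun m => if 0 < m ∧ k ∣ m then (k : R) else 0

open PowerSeries in
theorem auxL_spec (R : Type*) [CommRing R] (k : ℕ) (hk : 0 < k) :
    X * d⁄dX R (1 - X^k : R⟦X⟧) = - ((1 - X^k) * auxL R k) := by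
  have e1 : X * d⁄dX R (1 - X^k : R⟦X⟧) = - (C (k : R) * X^k) := by
    obtain ⟨j, rfl⟩ : ∃ j, k = j + 1 := ⟨k - 1, by omega⟩
    simp only [map_sub, Derivation.leibniz_pow, Derivation.map_one_eq_zero, Nat.add_sub_cancel,
      derivative_X, smul_eq_mul, nsmul_eq_mul, mul_one, map_natCast]
    ring
  rw [e1]
  congr 1
  ext m
  rw [sub_mul, one_mul, map_sub, coeff_C_mul, coeff_X_pow, coeff_X_pow_mul', auxL, coeff_mk,
    coeff_mk]
  rcases lt_trichotomy m k with hlt | rfl | hgt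
  · have : ¬ (0 < m ∧ k ∣ m) := fun ⟨a, b⟩ => absurd (Nat.le_of_dvd a b) (by omega)
    simp [this, hlt.ne, hlt]
  · simp [hk]
  · have : k ∣ m - k ↔ k ∣ m := (Nat.dvd_sub_iff_left hgt.le (dvd_refl k))
    simp [this, hgt.ne', hgt.le, hgt, hk.trans hgt]

open PowerSeries in
theorem aux_main (R : Type*) [CommRing R] (n : ℕ) :
    (X : R⟦X⟧)^(2*n+1) ∣ X * d⁄dX R (∑ s ∈ Finset.range (2*n), (X:R⟦X⟧)^(s*(s+1)/2))
      - (∑ s ∈ Finset.range (2*n), (X:R⟦X⟧)^(s*(s+1)/2)) *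
        (∑ k ∈ Finset.range n, auxL R (2*k+1) - ∑ k ∈ Finset.range n, auxL R (2*k+2)) := by
  rcases Nat.eq_zero_or_pos n with rfl | hn
  · simp
  set ψ := ∑ s ∈ Finset.range (2*n), (X:R⟦X⟧)^(s*(s+1)/2)
  have hs := aux_shanks (X : R⟦X⟧) (fun n => ∏ k ∈ Finset.range n, (1 - X^(2*k+1)))
    (fun s n => ∏ k ∈ Finset.Ico s n, (1 - X^(2*k+2)))
    (fun s => Finset.prod_range_succ _ _) (fun n => by simp)
    (fun s n h => Finset.prod_Ico_succ_top h _)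
    (fun s n h => Finset.prod_eq_prod_Ico_succ_bot h _) n
  have hD := aux_logderiv (R := R) (fun k => 1 - X^(2*k+1)) (fun k => auxL R (2*k+1))
    (fun k => auxL_spec R _ (by omega)) n
  have hE := aux_logderiv (R := R) (fun k => 1 - X^(2*k+2)) (fun k => auxL R (2*k+2))
    (fun k => auxL_spec R _ (by omega)) n
  change (∏ k ∈ Finset.range n, (1 - (X:R⟦X⟧)^(2*k+1))) * ψ = _ at hs
  obtain ⟨m, rfl⟩ : ∃ m, n = m + 1 := ⟨n - 1, by omega⟩
  rw [Finset.sum_range_succ'] at hs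
  simp only [Finset.range_zero, Finset.prod_empty, one_mul, zero_mul, pow_zero, mul_one,
    ← Finset.range_eq_Ico] at hs
  have hG : (X : R⟦X⟧)^(2*(m+1)+1) ∣ ∑ s ∈ Finset.range m,
      (∏ k ∈ Finset.range (s+1), (1 - (X:R⟦X⟧)^(2*k+1))) *
      (∏ k ∈ Finset.Ico (s+1) (m+1), (1 - (X:R⟦X⟧)^(2*k+2))) * X^((s+1)*(2*(m+1)+1)) := by
    refine Finset.dvd_sum fun s _ => Dvd.dvd.mul_left (pow_dvd_pow _ ?_) _
    nlinarith
  obtain ⟨G, hG⟩ := hG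
  rw [hG] at hs
  have hu : IsUnit (∏ k ∈ Finset.range (m+1), (1 - (X:R⟦X⟧)^(2*k+1))) := by
    rw [PowerSeries.isUnit_iff_constantCoeff]
    simp
  set D := ∏ k ∈ Finset.range (m+1), (1 - (X:R⟦X⟧)^(2*k+1))
  set E := ∏ k ∈ Finset.range (m+1), (1 - (X:R⟦X⟧)^(2*k+2))
  have hd := congrArg (fun f => X * d⁄dX R f) hs
  simp only [Derivation.leibniz, map_add, smul_eq_mul, Derivation.leibniz_pow, nsmul_eq_mul,
    derivative_X, mul_one, Nat.add_sub_cancel] at hd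
  rw [← hu.dvd_mul_left]
  set a := ∑ k ∈ Finset.range (m+1), auxL R (2*k+1)
  set b := ∑ k ∈ Finset.range (m+1), auxL R (2*k+2)
  refine ⟨X * d⁄dX R G + G * ((2*(m+1)+1 : ℕ) : R⟦X⟧) + G * b, ?_⟩
  linear_combination hd + hE - ψ * hD + b * hs

theorem aux_coeff (n m : ℕ) (h : m ≤ 2 * n) :
    PowerSeries.coeff m (∑ k ∈ Finset.range n, auxL (ZMod 4) (2*k+1)
      - ∑ k ∈ Finset.range n, auxL (ZMod 4) (2*k+2)) = ((∑ d ∈ m.divisors, (d:ℤ) : ℤ) : ZMod 4) := by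
  have h0 : ∀ n, ∑ k ∈ Finset.range n, auxL (ZMod 4) (2*k+1)
      - ∑ k ∈ Finset.range n, auxL (ZMod 4) (2*k+2)
      = ∑ k ∈ Finset.range (2*n), (-1)^k * auxL (ZMod 4) (k+1) := by
    intro n
    induction n with
    | zero => simp
    | succ n ih =>
      rw [show 2*(n+1) = 2*n+1+1 by ring, Finset.sum_range_succ _ (2*n+1),
        Finset.sum_range_succ _ (2*n), ← ih, Finset.sum_range_succ, Finset.sum_range_succ]
      rw [pow_succ, pow_mul]
      norm_num
      ring
  have h4 : ∀ k : ℕ, (-1 : ZMod 4)^k * ((k+1 : ℕ) : ZMod 4) = ((k+1 : ℕ) : ZMod 4) := by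
    intro k
    rcases Nat.even_or_odd' k with ⟨j, rfl | rfl⟩
    · simp
    · rw [pow_succ, pow_mul]
      push_cast
      have : (4 : ZMod 4) = 0 := rfl
      linear_combination (norm := (simp; ring)) (-(j:ZMod 4) - 1) * this
  rw [h0, map_sum]
  have h5 : ∀ k, PowerSeries.coeff m ((-1)^k * auxL (ZMod 4) (k+1)) =
      if 0 < m ∧ (k+1) ∣ m then ((k+1 : ℕ) : ZMod 4) else 0 := by
    intro k
    rw [show ((-1 : PowerSeries (ZMod 4))^k) = PowerSeries.C ((-1 : ZMod 4)^k) by simp,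
      PowerSeries.coeff_C_mul, auxL, PowerSeries.coeff_mk]
    split_ifs
    · exact h4 k
    · simp
  simp_rw [h5]
  rcases Nat.eq_zero_or_pos m with rfl | hm
  · simp
  push_cast
  rw [← Finset.sum_filter]
  refine Finset.sum_bij (fun k _ => k + 1) ?_ ?_ ?_ ?_
  · intro k hk; simp at hk ⊢; exact ⟨hk.2.2, hm.ne'⟩
  · intro a _ b _ h; simpa using h
  · intro d hd
    have h1 := Nat.pos_of_mem_divisors hd
    have h2 := Nat.divisor_le hd
    have h3 := Nat.dvd_of_mem_divisors hd
    refine ⟨d - 1, ?_, by omega⟩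
    simp only [Finset.mem_filter, Finset.mem_range]
    rw [show d - 1 + 1 = d by omega]
    exact ⟨by omega, hm, h3⟩
  · intro k _; simp

theorem sum_sigma_minus_triangular_mod_four (n : ℕ) (hn : 0 < n)
    (h : ∀ k : ℕ, 2 * n ≠ k * (k + 1)) :
    (4 : ℤ) ∣ ∑ᶠ j : ℕ, sigmaZ ((n : ℤ) - (j : ℤ) * ((j : ℤ) + 1) / 2) := by
  have htri : ∀ s : ℕ, 2 * (s * (s+1) / 2) = s * (s+1) := fun s =>
    Nat.mul_div_cancel' (Nat.even_mul_succ_self s).two_dvd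
  have hZ : ∀ j : ℕ, ((n : ℤ) - (j : ℤ) * ((j : ℤ) + 1) / 2).toNat = n - j * (j+1) / 2 := by
    intro j
    have : (j : ℤ) * ((j : ℤ) + 1) / 2 = ((j * (j+1) / 2 : ℕ) : ℤ) := by push_cast; rfl
    rw [this]; omega
  have hsum : ∑ᶠ j : ℕ, sigmaZ ((n : ℤ) - (j : ℤ) * ((j : ℤ) + 1) / 2) =
      ∑ j ∈ Finset.range (2*n), sigmaZ ((n : ℤ) - (j : ℤ) * ((j : ℤ) + 1) / 2) := by
    refine finsum_eq_sum_of_support_subset _ ?_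
    intro j hj
    by_contra hc
    apply hj
    have hc : 2 * n ≤ j := by simpa using hc
    have h2 := htri j
    have : n - j * (j+1) / 2 = 0 := by
      have : 2 * n ≤ j * (j+1) := by nlinarith
      omega
    simp only [sigmaZ]
    rw [hZ, this]; simp
  rw [hsum]
  refine (ZMod.intCast_zmod_eq_zero_iff_dvd _ 4).1 ?_
  have hm := PowerSeries.X_pow_dvd_iff.1 (aux_main (ZMod 4) n) n (by omega)
  have hψ : ∀ s, PowerSeries.coeff n ((PowerSeries.X : PowerSeries (ZMod 4))^(s*(s+1)/2)) = 0 := by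
    intro s
    rw [PowerSeries.coeff_X_pow, if_neg]
    intro e
    apply h s
    rw [← htri s, ← e]
  have hd : PowerSeries.coeff n (PowerSeries.X * PowerSeries.derivative (ZMod 4)
      (∑ s ∈ Finset.range (2*n), (PowerSeries.X : PowerSeries (ZMod 4))^(s*(s+1)/2))) = 0 := by
    obtain ⟨m, rfl⟩ : ∃ m, n = m + 1 := ⟨n - 1, by omega⟩
    rw [PowerSeries.coeff_succ_X_mul, PowerSeries.coeff_derivative, map_sum,
      Finset.sum_eq_zero (fun s _ => hψ s), zero_mul]
  rw [map_sub, hd, zero_sub, neg_eq_zero, Finset.sum_mul, map_sum] at hm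
  rw [Int.cast_sum, ← hm]
  refine Finset.sum_congr rfl fun s _ => ?_
  rw [PowerSeries.coeff_X_pow_mul', sigmaZ, hZ]
  split_ifs with hle
  · rw [aux_coeff n _ (by omega)]
  · rw [show n - s * (s+1) / 2 = 0 by omega]; simp
end

section
/- For every positive integer n, Σ_{j≥0} ( σ(n − j(j+1)/2) − 4·σ((n − j(j+1)/2)/2) ) equals n if n = k(k+1)/2 for some integer k, and equals 0 otherwise. Here the sum is over all integers j ≥ 0, only finitely many terms are nonzero, and σ(m/2) is taken to be 0 when m is odd. -/
/-- `sigmaHalf m = sigmaZ (m / 2)` when `m` is even, and `0` when `m` is odd. -/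
def sigmaHalf (m : ℤ) : ℤ := if 2 ∣ m then sigmaZ (m / 2) else 0

open PowerSeries in
/-- Finite products `∏ (1 - X^(2r)) / (1 - X^(2r-1))`. -/
noncomputable def gP : ℕ → PowerSeries ℚ
  | 0 => 1
  | s + 1 => gP s * (1 - X ^ (2 * s + 2)) * (1 - X ^ (2 * s + 1))⁻¹

/-- The series `X^d / (1 - X^d)`. -/
noncomputable def gG (d : ℕ) : PowerSeries ℚ :=
  PowerSeries.mk fun m => if d ∣ m ∧ m ≠ 0 then 1 else 0

/-- Logarithmic derivative of `gP N`. -/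
noncomputable def gL (N : ℕ) : PowerSeries ℚ :=
  ∑ i ∈ Finset.range (2 * N), ((-1) ^ i * ((i : PowerSeries ℚ) + 1)) * gG (i + 1)

open PowerSeries

theorem one_sub_ne (k : ℕ) : constantCoeff (1 - X ^ (k + 1) : PowerSeries ℚ) ≠ 0 := by
  simp

theorem one_sub_ne' (k : ℕ) : (1 - X ^ (k + 1) : PowerSeries ℚ) ≠ 0 := by
  intro h
  have := one_sub_ne k
  rw [h] at this
  simp at this

theorem gP_const (s : ℕ) : constantCoeff (gP s) ≠ 0 := by
  induction s with
  | zero => simp [gP]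
  | succ s ih => simp [gP, ih]

theorem gP_succ (s : ℕ) :
    gP (s + 1) * (1 - X ^ (2 * s + 1)) = gP s * (1 - X ^ (2 * s + 2)) := by
  rw [gP, mul_assoc, PowerSeries.inv_mul_cancel _ (one_sub_ne _), mul_one]

theorem gP_inv_succ (s : ℕ) :
    (gP (s + 1))⁻¹ * (1 - X ^ (2 * s + 2)) = (gP s)⁻¹ * (1 - X ^ (2 * s + 1)) := by
  have h1 := PowerSeries.mul_inv_cancel _ (gP_const s)
  have h2 := PowerSeries.mul_inv_cancel _ (gP_const (s + 1))
  have h := gP_succ s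
  linear_combination (-(gP (s+1))⁻¹ * (gP s)⁻¹) * h
    - (gP (s + 1))⁻¹ * (1 - X ^ (2 * s + 2)) * h1 + (gP s)⁻¹ * (1 - X ^ (2 * s + 1)) * h2

theorem gG_mul (k : ℕ) : (1 - X ^ (k + 1)) * gG (k + 1) = X ^ (k + 1) := by
  ext m
  rw [sub_mul, one_mul, map_sub, coeff_X_pow_mul', coeff_X_pow]
  simp only [gG, coeff_mk]
  by_cases h : k + 1 ≤ m
  · obtain ⟨t, rfl⟩ := Nat.exists_eq_add_of_le h
    have e : k + 1 + t - (k + 1) = t := by omega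
    rw [e]
    have e1 : (k + 1 ∣ k + 1 + t) ↔ k + 1 ∣ t := by simp
    simp only [e1]
    by_cases ht : t = 0
    · subst ht; simp
    · by_cases hd : k + 1 ∣ t <;> simp [hd, ht]
  · have : ¬ (k + 1 ∣ m ∧ m ≠ 0) := fun ⟨a, b⟩ => h (Nat.le_of_dvd (Nat.pos_of_ne_zero b) a)
    have h3 : m ≠ k + 1 := by omega
    rw [if_neg this, if_neg h, if_neg h3]; simp

theorem theta_one_sub (k : ℕ) :
    X * derivative ℚ (1 - X ^ (k + 1) : PowerSeries ℚ) = -((k : PowerSeries ℚ) + 1) * X ^ (k + 1) := by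
  rw [map_sub, Derivation.leibniz_pow]
  simp
  ring

theorem gP_theta (N : ℕ) : X * derivative ℚ (gP N) = gP N * gL N := by
  induction N with
  | zero => simp [gP, gL]
  | succ s ih =>
    have h := gP_succ s
    have hd := congrArg (fun f => X * derivative ℚ f) h
    simp only [Derivation.leibniz, smul_eq_mul] at hd
    have t1 := theta_one_sub (2 * s)
    have t2 := theta_one_sub (2 * s + 1)
    have g1 := gG_mul (2 * s)
    have g2 := gG_mul (2 * s + 1)
    have hL : gL (s + 1) = gL s + (2 * s + 1) * gG (2 * s + 1) - (2 * s + 2) * gG (2 * s + 2) := by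
      have e : 2 * (s + 1) = 2 * s + 1 + 1 := by ring
      rw [gL, e, Finset.sum_range_succ, Finset.sum_range_succ, ← gL]
      simp only [pow_succ, pow_mul]
      push_cast
      simp
      ring
    apply mul_right_cancel₀ (one_sub_ne' (2 * s))
    rw [hL]
    push_cast at t1 t2
    simp only [show 2 * s + 1 + 1 = 2 * s + 2 by ring] at t2 g2
    linear_combination hd - gP (s + 1) * t1 + gP s * t2 + (1 - X ^ (2 * s + 2)) * ih
      - gL s * h - gP (s + 1) * (2 * s + 1) * g1 + gP s * (2 * s + 2) * g2
      + (2 * s + 2) * gG (2 * s + 2) * h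

/-- Shanks' sum. -/
noncomputable def gA (n : ℕ) : PowerSeries ℚ :=
  ∑ s ∈ Finset.range n, gP n * (gP s)⁻¹ * X ^ (s * (2 * n + 1))

theorem gA_tele (n m : ℕ) :
    ∑ s ∈ Finset.range m, (gP (n + 1) * (gP s)⁻¹ * X ^ (s * (2 * n + 3))
        - gP n * (gP s)⁻¹ * X ^ (s * (2 * n + 1))) * (1 - X ^ (2 * n + 1))
      = gP n * (X ^ (m * (2 * n + 1)) * (1 - X ^ (2 * m)) * (gP m)⁻¹) := by
  induction m with
  | zero => simp
  | succ m ih =>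
    rw [Finset.sum_range_succ, ih]
    have h := gP_succ n
    have hi := gP_inv_succ m
    rw [show 2 * (m + 1) = 2 * m + 2 by ring]
    linear_combination (gP m)⁻¹ * X ^ (m * (2 * n + 3)) * h
      - gP n * X ^ ((m + 1) * (2 * n + 1)) * hi

theorem shanks (n : ℕ) : gA n = ∑ j ∈ Finset.range (2 * n), X ^ (j * (j + 1) / 2) := by
  induction n with
  | zero => simp [gA]
  | succ n ih =>
    have e : 2 * (n + 1) = 2 * n + 1 + 1 := by ring
    rw [e, Finset.sum_range_succ, Finset.sum_range_succ, ← ih]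
    have e1 : 2 * n * (2 * n + 1) / 2 = n * (2 * n + 1) := by
      rw [mul_assoc]; exact Nat.mul_div_cancel_left _ (by norm_num)
    have e2 : (2 * n + 1) * (2 * n + 1 + 1) / 2 = (n + 1) * (2 * n + 1) := by
      rw [show (2 * n + 1) * (2 * n + 1 + 1) = 2 * ((n + 1) * (2 * n + 1)) by ring]
      exact Nat.mul_div_cancel_left _ (by norm_num)
    rw [e1, e2]
    apply mul_right_cancel₀ (one_sub_ne' (2 * n))
    have ht := gA_tele n n
    rw [← Finset.sum_mul, Finset.sum_sub_distrib] at ht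
    have hA : gA (n + 1) = ∑ s ∈ Finset.range n, gP (n + 1) * (gP s)⁻¹ * X ^ (s * (2 * n + 3))
        + gP (n + 1) * (gP n)⁻¹ * X ^ (n * (2 * n + 3)) := by
      rw [gA, Finset.sum_range_succ]
      simp only [show 2 * (n + 1) + 1 = 2 * n + 3 by ring]
    rw [hA]
    rw [← gA] at ht
    have h := gP_succ n
    have h1 := PowerSeries.mul_inv_cancel _ (gP_const n)
    linear_combination ht + (gP n)⁻¹ * X ^ (n * (2 * n + 3)) * h
      + (X ^ (n * (2 * n + 3)) * (1 - X ^ (2 * n + 2))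
        + X ^ (n * (2 * n + 1)) * (1 - X ^ (2 * n))) * h1

theorem shanks_mod (n : ℕ) (hn : 0 < n) : ∃ R : PowerSeries ℚ,
    ∑ j ∈ Finset.range (2 * n), X ^ (j * (j + 1) / 2) = gP n + X ^ (2 * n + 1) * R := by
  obtain ⟨m, rfl⟩ : ∃ m, n = m + 1 := ⟨n - 1, by omega⟩
  refine ⟨∑ s ∈ Finset.range m, gP (m + 1) * (gP (s + 1))⁻¹ * X ^ (s * (2 * (m + 1) + 1)), ?_⟩
  rw [← shanks, gA, Finset.sum_range_succ', Finset.mul_sum, add_comm]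
  congr 1
  · simp [gP]
  · refine Finset.sum_congr rfl fun s _ => ?_
    ring

theorem main_ps (n : ℕ) (hn : 0 < n) :
    coeff n (X * derivative ℚ (∑ j ∈ Finset.range (2 * n), X ^ (j * (j + 1) / 2) : PowerSeries ℚ))
      = coeff n ((∑ j ∈ Finset.range (2 * n), X ^ (j * (j + 1) / 2) : PowerSeries ℚ) * gL n) := by
  obtain ⟨R, hR⟩ := shanks_mod n hn
  have h := gP_theta n
  have t : X * derivative ℚ (X ^ (2 * n + 1) : PowerSeries ℚ)
      = (2 * (n : PowerSeries ℚ) + 1) * (X ^ (2 * n + 1) : PowerSeries ℚ) := by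
    rw [Derivation.leibniz_pow]; simp; ring
  rw [← sub_eq_zero, ← map_sub (coeff n), hR]
  have : X * derivative ℚ (gP n + X ^ (2 * n + 1) * R) - (gP n + X ^ (2 * n + 1) * R) * gL n
     = X ^ (2 * n + 1) * (X * derivative ℚ R + (2 * (n : PowerSeries ℚ) + 1) * R - R * gL n) := by
    rw [map_add, Derivation.leibniz]
    simp only [smul_eq_mul]
    linear_combination h + R * t
  rw [this, coeff_X_pow_mul', if_neg (by omega)]

theorem coeff_gL (N m : ℕ) (hm : m ≤ 2 * N) :
    coeff m (gL N) = ∑ d ∈ m.divisors, (-1 : ℚ) ^ (d + 1) * d := by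
  have hc : ∀ i : ℕ, coeff m (((-1) ^ i * ((i : PowerSeries ℚ) + 1)) * gG (i + 1))
      = if (i + 1) ∣ m ∧ m ≠ 0 then (-1 : ℚ) ^ (i + 1 + 1) * ((i + 1 : ℕ) : ℚ) else 0 := by
    intro i
    have : ((-1) ^ i * ((i : PowerSeries ℚ) + 1)) = C ((-1 : ℚ) ^ i * (i + 1)) := by simp
    rw [this, coeff_C_mul, gG, coeff_mk]
    split_ifs
    · push_cast; ring
    · simp
  rw [gL, map_sum, Finset.sum_congr rfl fun i _ => hc i]
  rw [← Finset.sum_filter]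
  refine Finset.sum_bij (fun i _ => i + 1) ?_ ?_ ?_ ?_
  · intro i hi; simpa using (Finset.mem_filter.1 hi).2
  · intro a _ b _ h; simpa using h
  · intro d hd
    have h1 := Nat.mem_divisors.1 hd
    have h2 := Nat.pos_of_mem_divisors hd
    have h3 := Nat.divisor_le hd
    refine ⟨d - 1, ?_, by omega⟩
    rw [Finset.mem_filter, Finset.mem_range, Nat.sub_add_cancel h2]
    exact ⟨by omega, h1⟩
  · intro i _; rfl

theorem sigma_alt (m : ℕ) :
    sigmaZ m - 4 * sigmaHalf m = ∑ d ∈ m.divisors, (-1 : ℤ) ^ (d + 1) * d := by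
  have h1 : sigmaHalf m = ∑ d ∈ m.divisors with 2 ∣ d, ((d / 2 : ℕ) : ℤ) := by
    unfold sigmaHalf
    split_ifs with h
    · obtain ⟨k, rfl⟩ : 2 ∣ m := by exact_mod_cast h
      have : ((2 * k : ℕ) : ℤ) / 2 = k := by push_cast; omega
      rw [this, sigmaZ, Int.toNat_natCast]
      refine Finset.sum_bij (fun d _ => 2 * d) ?_ ?_ ?_ ?_
      · intro d hd
        have := Nat.mem_divisors.1 hd
        simp only [Finset.mem_filter, Nat.mem_divisors]
        exact ⟨⟨Nat.mul_dvd_mul_left 2 this.1, by omega⟩, by simp⟩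
      · intro a _ b _ h; simpa using h
      · intro d hd
        simp only [Finset.mem_filter, Nat.mem_divisors] at hd
        obtain ⟨⟨a, b⟩, c, rfl⟩ := hd
        exact ⟨c, Nat.mem_divisors.2 ⟨Nat.dvd_of_mul_dvd_mul_left (by norm_num) a, by omega⟩, rfl⟩
      · intro d _; simp
    · symm
      apply Finset.sum_eq_zero
      intro d hd
      simp only [Finset.mem_filter, Nat.mem_divisors] at hd
      exact absurd (by exact_mod_cast hd.2.trans hd.1.1) h
  rw [h1, sigmaZ, Int.toNat_natCast, Finset.sum_filter, Finset.mul_sum, ← Finset.sum_sub_distrib]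
  refine Finset.sum_congr rfl fun d _ => ?_
  split_ifs with h
  · obtain ⟨c, rfl⟩ := h
    simp [pow_succ, pow_mul]
    ring
  · have : Even (d + 1) := by
      rw [Nat.even_add_one, even_iff_two_dvd]; exact h
    simp [this.neg_one_pow]

theorem sigma_nonpos (m : ℤ) (hm : m ≤ 0) : sigmaZ m - 4 * sigmaHalf m = 0 := by
  have h : ∀ k : ℤ, k ≤ 0 → sigmaZ k = 0 := by
    intro k hk; simp [sigmaZ, Int.toNat_of_nonpos hk]
  have h2 : sigmaHalf m = 0 := by
    unfold sigmaHalf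
    split_ifs
    · exact h _ (by omega)
    · rfl
  rw [h m hm, h2]; simp

open scoped Classical in
theorem sigma_recurrence_two (n : ℕ) (hn : 0 < n) :
    ∑ᶠ j : ℕ,
        (sigmaZ ((n : ℤ) - (j : ℤ) * ((j : ℤ) + 1) / 2) -
          4 * sigmaHalf ((n : ℤ) - (j : ℤ) * ((j : ℤ) + 1) / 2)) =
      if ∃ k : ℕ, 2 * n = k * (k + 1) then (n : ℤ) else 0 := by
  have hcast : ∀ j : ℕ, (j : ℤ) * ((j : ℤ) + 1) / 2 = ((j * (j + 1) / 2 : ℕ) : ℤ) := by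
    intro j; push_cast; rfl
  have hT : ∀ j : ℕ, 2 * (j * (j + 1) / 2) = j * (j + 1) := fun j =>
    Nat.mul_div_cancel' (Nat.even_mul_succ_self j).two_dvd
  have hTle : ∀ j : ℕ, j ≤ j * (j + 1) / 2 := by
    intro j; have := hT j
    rcases Nat.eq_zero_or_pos j with h | h
    · omega
    · nlinarith
  rw [finsum_eq_sum_of_support_subset (s := Finset.range (2 * n))]
  swap
  · intro j hj
    by_contra hc
    apply hj
    have h1 : 2 * n ≤ j := by simpa using hc
    apply sigma_nonpos
    rw [hcast]
    have := hTle j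
    omega
  have key := main_ps n hn
  rw [Finset.sum_mul, map_sum (coeff n)] at key
  have hr : ∀ j ∈ Finset.range (2 * n), coeff n (X ^ (j * (j + 1) / 2) * gL n) =
      ((sigmaZ ((n : ℤ) - (j : ℤ) * ((j : ℤ) + 1) / 2) -
          4 * sigmaHalf ((n : ℤ) - (j : ℤ) * ((j : ℤ) + 1) / 2) : ℤ) : ℚ) := by
    intro j _
    rw [coeff_X_pow_mul', hcast]
    split_ifs with h
    · rw [← Nat.cast_sub h, sigma_alt, coeff_gL _ _ (by omega)]
      push_cast; rfl
    · rw [sigma_nonpos _ (by omega)]; simp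
  rw [Finset.sum_congr rfl hr, ← Int.cast_sum] at key
  have hl : coeff n (X * derivative ℚ
      (∑ j ∈ Finset.range (2 * n), X ^ (j * (j + 1) / 2) : PowerSeries ℚ))
      = ((if ∃ k : ℕ, 2 * n = k * (k + 1) then (n : ℤ) else 0 : ℤ) : ℚ) := by
    obtain ⟨m, rfl⟩ : ∃ m, n = m + 1 := ⟨n - 1, by omega⟩
    rw [coeff_succ_X_mul, coeff_derivative, map_sum]
    simp only [coeff_X_pow]
    split_ifs with h
    · obtain ⟨k, hk⟩ := h
      have hk' := hT k
      have hk2 := hTle k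
      rw [Finset.sum_eq_single k]
      · rw [if_pos (by omega)]; push_cast; ring
      · intro b _ hb
        rw [if_neg]
        intro h
        have := hT b
        have h3 : b * (b + 1) = k * (k + 1) := by omega
        apply hb
        rcases lt_trichotomy b k with h | h | h
        · nlinarith
        · exact h
        · nlinarith
      · intro h; simp at h; omega
    · rw [Finset.sum_eq_zero]
      · simp
      · intro b _
        rw [if_neg]
        intro hb
        exact h ⟨b, by rw [hb]; exact hT b⟩
  rw [hl] at key
  exact_mod_cast key.symm
end

section
/- (Legendre) For every nonnegative integer n, t_4(n) = σ(2n+1), where t_4(n) is the number of ordered quadruples (a,b,c,d) of nonnegative integers with a(a+1)/2 + b(b+1)/2 + c(c+1)/2 + d(d+1)/2 = n. -/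
/-- Sum of the positive divisors of `n`. -/
def sigma' (n : ℕ) : ℕ := ∑ d ∈ n.divisors, d

/-- Number of ordered quadruples of nonnegative integers whose triangular numbers sum to `m`. -/
noncomputable def t4 (m : ℕ) : ℕ :=
  Set.ncard {x : ℕ × ℕ × ℕ × ℕ |
    x.1 * (x.1 + 1) / 2 + x.2.1 * (x.2.1 + 1) / 2 + x.2.2.1 * (x.2.2.1 + 1) / 2 +
      x.2.2.2 * (x.2.2.2 + 1) / 2 = m}

namespace LegT4

/-- triangular numbers -/
def T (a : ℕ) : ℕ := a * (a + 1) / 2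

lemma two_T (a : ℕ) : 2 * T a = a * (a + 1) := by
  unfold T
  exact Nat.mul_div_cancel' (Nat.even_mul_succ_self a).two_dvd

lemma le_T (a : ℕ) : a ≤ T a := by
  have := two_T a
  rcases Nat.eq_zero_or_pos a with h | h
  · omega
  · nlinarith

/-- Zagier-type set of solutions of x² + 4yz = M. -/
noncomputable def S (M : ℤ) : Finset (ℤ × ℤ × ℤ) :=
  (Finset.Icc (-M) M ×ˢ Finset.Icc 1 M ×ˢ Finset.Icc 1 M).filter
    (fun p => p.1 ^ 2 + 4 * (p.2.1 * p.2.2) = M)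

lemma mem_S {M x y z : ℤ} : (x, y, z) ∈ S M ↔ 0 < y ∧ 0 < z ∧ x ^ 2 + 4 * (y * z) = M := by
  simp only [S, Finset.mem_filter, Finset.mem_product, Finset.mem_Icc]
  constructor
  · rintro ⟨⟨_, ⟨h1, _⟩, ⟨h2, _⟩⟩, h⟩
    exact ⟨by omega, by omega, h⟩
  · rintro ⟨h1, h2, h⟩
    have h3 : 0 < y * z := mul_pos h1 h2
    have h4 : y ≤ y * z := by nlinarith
    have h5 : z ≤ y * z := by nlinarith
    have h6 : 0 ≤ x ^ 2 := sq_nonneg x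
    refine ⟨⟨⟨?_, ?_⟩, ⟨?_, ?_⟩, ⟨?_, ?_⟩⟩, h⟩ <;> first | omega | nlinarith

lemma odd_S {n : ℕ} {x y z : ℤ} (h : x ^ 2 + 4 * (y * z) = 8 * n + 5) :
    x % 2 = 1 ∧ y % 2 = 1 ∧ z % 2 = 1 := by
  have hx : x % 2 = 1 := by
    rcases Int.emod_two_eq_zero_or_one x with h0 | h0
    · obtain ⟨k, rfl⟩ := Int.dvd_of_emod_eq_zero h0
      ring_nf at h
      omega
    · exact h0
  have hyz : (y * z) % 2 = 1 := by
    obtain ⟨k, hk⟩ : ∃ k, x = 2 * k + 1 := ⟨x / 2, by omega⟩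
    subst hk
    obtain ⟨j, hj⟩ := (Int.even_mul_succ_self k).two_dvd
    have : (2 * k + 1) ^ 2 = 8 * j + 1 := by linear_combination 4 * hj
    omega
  have h2 := Int.odd_mul.mp (Int.odd_iff.mpr hyz)
  exact ⟨hx, Int.odd_iff.mp h2.1, Int.odd_iff.mp h2.2⟩

lemma sum_flip (M : ℤ) (F : ℤ → ℤ → ℤ → ℤ) :
    ∑ p ∈ S M, F p.1 p.2.1 p.2.2 = ∑ p ∈ S M, F (-p.1) p.2.1 p.2.2 := by
  refine Finset.sum_nbij' (fun p => (-p.1, p.2.1, p.2.2)) (fun p => (-p.1, p.2.1, p.2.2))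
    ?_ ?_ ?_ ?_ ?_
  · rintro ⟨x, y, z⟩ h; rw [mem_S] at h ⊢; simpa using h
  · rintro ⟨x, y, z⟩ h; rw [mem_S] at h ⊢; simpa using h
  · rintro ⟨x, y, z⟩ h; simp
  · rintro ⟨x, y, z⟩ h; simp
  · rintro ⟨x, y, z⟩ h; simp

lemma sum_swap (M : ℤ) (F : ℤ → ℤ → ℤ → ℤ) :
    ∑ p ∈ S M, F p.1 p.2.1 p.2.2 = ∑ p ∈ S M, F p.1 p.2.2 p.2.1 := by
  refine Finset.sum_nbij' (fun p => (p.1, p.2.2, p.2.1)) (fun p => (p.1, p.2.2, p.2.1))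
    ?_ ?_ ?_ ?_ ?_
  · rintro ⟨x, y, z⟩ h
    rw [mem_S] at h ⊢
    exact ⟨h.2.1, h.1, by rw [mul_comm z y]; exact h.2.2⟩
  · rintro ⟨x, y, z⟩ h
    rw [mem_S] at h ⊢
    exact ⟨h.2.1, h.1, by rw [mul_comm z y]; exact h.2.2⟩
  · rintro ⟨x, y, z⟩ h; simp
  · rintro ⟨x, y, z⟩ h; simp
  · rintro ⟨x, y, z⟩ h; simp

/-- half of the set -/
noncomputable def A (M : ℤ) : Finset (ℤ × ℤ × ℤ) := (S M).filter (fun p => 0 < p.2.1 + p.1 - p.2.2)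

lemma sum_half (n : ℕ) (F : ℤ → ℤ → ℤ → ℤ) (hF : ∀ x y z, F (-x) z y = F x y z) :
    ∑ p ∈ S (8 * n + 5), F p.1 p.2.1 p.2.2 = 2 * ∑ p ∈ A (8 * n + 5), F p.1 p.2.1 p.2.2 := by
  rw [← Finset.sum_filter_add_sum_filter_not _ (fun p => 0 < p.2.1 + p.1 - p.2.2), two_mul]
  congr 1
  refine Finset.sum_nbij' (fun p => (-p.1, p.2.2, p.2.1)) (fun p => (-p.1, p.2.2, p.2.1))
    ?_ ?_ ?_ ?_ ?_
  · rintro ⟨x, y, z⟩ h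
    rw [Finset.mem_filter, mem_S] at h
    rw [A, Finset.mem_filter, mem_S]
    obtain ⟨⟨h1, h2, h3⟩, h4⟩ := h
    have := odd_S h3
    dsimp only at *
    exact ⟨⟨h2, h1, by rw [mul_comm z y, neg_sq]; exact h3⟩, by omega⟩
  · rintro ⟨x, y, z⟩ h
    rw [A, Finset.mem_filter, mem_S] at h
    rw [Finset.mem_filter, mem_S]
    obtain ⟨⟨h1, h2, h3⟩, h4⟩ := h
    dsimp only at *
    exact ⟨⟨h2, h1, by rw [mul_comm z y, neg_sq]; exact h3⟩, by omega⟩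
  · rintro ⟨x, y, z⟩ h; simp
  · rintro ⟨x, y, z⟩ h; simp
  · rintro ⟨x, y, z⟩ h; simp [hF]

lemma sum_tau (M : ℤ) (F : ℤ → ℤ → ℤ → ℤ) :
    ∑ p ∈ A M, F p.1 p.2.1 p.2.2 =
      ∑ p ∈ A M, F (2 * p.2.2 - p.1) (p.2.1 + p.1 - p.2.2) p.2.2 := by
  refine Finset.sum_nbij' (fun p => (2 * p.2.2 - p.1, p.2.1 + p.1 - p.2.2, p.2.2))
    (fun p => (2 * p.2.2 - p.1, p.2.1 + p.1 - p.2.2, p.2.2)) ?_ ?_ ?_ ?_ ?_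
  · rintro ⟨x, y, z⟩ h
    rw [A, Finset.mem_filter, mem_S] at h ⊢
    obtain ⟨⟨h1, h2, h3⟩, h4⟩ := h
    dsimp only at *
    exact ⟨⟨h4, h2, by rw [← h3]; ring⟩, by omega⟩
  · rintro ⟨x, y, z⟩ h
    rw [A, Finset.mem_filter, mem_S] at h ⊢
    obtain ⟨⟨h1, h2, h3⟩, h4⟩ := h
    dsimp only at *
    exact ⟨⟨h4, h2, by rw [← h3]; ring⟩, by omega⟩
  · rintro ⟨x, y, z⟩ h; ext <;> dsimp only <;> ring
  · rintro ⟨x, y, z⟩ h; ext <;> dsimp only <;> ring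
  · rintro ⟨x, y, z⟩ h
    dsimp only
    congr 1 <;> ring

lemma key (n : ℕ) : ∑ p ∈ S (8 * n + 5), (p.2.1 * p.2.2 - p.1 ^ 2) * p.2.1 = 0 := by
  have h1 := sum_swap (8 * n + 5) (fun x y z => (y * z - x ^ 2) * y)
  have h2 := sum_half n (fun x y z => (y * z - x ^ 2) * (y + z)) (by intros; ring)
  have h3 := sum_half n (fun x y z => x * (y ^ 2 - z ^ 2)) (by intros; ring)
  have h4 := sum_flip (8 * n + 5) (fun x y z => x * (y ^ 2 - z ^ 2))
  have h5 := sum_tau (8 * n + 5)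
    (fun x y z => (y * z - x ^ 2) * (y + z) - x * (y ^ 2 - z ^ 2))
  have h6 : ∑ p ∈ A (8 * n + 5),
      ((p.2.1 * p.2.2 - p.1 ^ 2) * (p.2.1 + p.2.2) - p.1 * (p.2.1 ^ 2 - p.2.2 ^ 2)) = 0 := by
    have : ∀ a b : ℤ, a = b → b = -a → a = 0 := by intros; omega
    refine this _ _ h5 ?_
    rw [← Finset.sum_neg_distrib]
    refine Finset.sum_congr rfl fun p _ => ?_
    ring
  simp only [neg_mul, Finset.sum_neg_distrib] at h4
  rw [Finset.sum_sub_distrib] at h6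
  have h7 : ∑ p ∈ S (8 * n + 5), (p.2.1 * p.2.2 - p.1 ^ 2) * (p.2.1 + p.2.2) =
      ∑ p ∈ S (8 * n + 5), (p.2.1 * p.2.2 - p.1 ^ 2) * p.2.1 +
      ∑ p ∈ S (8 * n + 5), (p.2.2 * p.2.1 - p.1 ^ 2) * p.2.2 := by
    rw [← Finset.sum_add_distrib]
    refine Finset.sum_congr rfl fun p _ => ?_
    ring
  omega

/-- quadruples -/
def Q (n : ℕ) : Finset (ℕ × ℕ × ℕ × ℕ) :=
  (Finset.range (n + 1) ×ˢ Finset.range (n + 1) ×ˢ Finset.range (n + 1) ×ˢ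
    Finset.range (n + 1)).filter (fun x => T x.1 + T x.2.1 + T x.2.2.1 + T x.2.2.2 = n)

lemma mem_Q {n a b c d : ℕ} : (a, b, c, d) ∈ Q n ↔ T a + T b + T c + T d = n := by
  simp only [Q, Finset.mem_filter, Finset.mem_product, Finset.mem_range]
  have := le_T a
  have := le_T b
  have := le_T c
  have := le_T d
  omega

lemma t4_eq (n : ℕ) : t4 n = (Q n).card := by
  rw [t4, ← Set.ncard_coe_finset]
  congr 1
  ext ⟨a, b, c, d⟩
  rw [Finset.mem_coe, mem_Q]
  rfl

/-- indices -/
def I (n : ℕ) : Finset ℕ := (Finset.range (n + 1)).filter (fun x => T x ≤ n)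

lemma mem_I {n x : ℕ} : x ∈ I n ↔ T x ≤ n := by
  simp only [I, Finset.mem_filter, Finset.mem_range]
  have := le_T x
  omega

/-- quintuples -/
def U (n : ℕ) : Finset (Σ _ : ℕ, ℕ × ℕ × ℕ × ℕ) := (I n).sigma (fun x => Q (n - T x))

lemma mem_U {n x a b c d : ℕ} :
    (⟨x, (a, b, c, d)⟩ : Σ _ : ℕ, ℕ × ℕ × ℕ × ℕ) ∈ U n ↔ T x + T a + T b + T c + T d = n := by
  rw [U, Finset.mem_sigma, mem_I, mem_Q]
  dsimp only
  omega

lemma rec_t4 (n : ℕ) : ∑ x ∈ I n, ((n : ℤ) - 5 * T x) * (t4 (n - T x) : ℤ) = 0 := by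
  have e : ∑ x ∈ I n, ((n : ℤ) - 5 * T x) * (t4 (n - T x) : ℤ) =
      ∑ p ∈ U n, ((n : ℤ) - 5 * T p.1) := by
    rw [U, Finset.sum_sigma]
    refine Finset.sum_congr rfl fun x _ => ?_
    dsimp only
    rw [t4_eq, Finset.sum_const, nsmul_eq_mul, mul_comm]
  have e1 : ∑ p ∈ U n, (T p.1 : ℤ) = ∑ p ∈ U n, (T p.2.1 : ℤ) := by
    refine Finset.sum_nbij' (fun p => ⟨p.2.1, (p.1, p.2.2.1, p.2.2.2.1, p.2.2.2.2)⟩)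
      (fun p => ⟨p.2.1, (p.1, p.2.2.1, p.2.2.2.1, p.2.2.2.2)⟩) ?_ ?_ ?_ ?_ ?_ <;>
    rintro ⟨x, a, b, c, d⟩ h <;> (try rw [mem_U] at *) <;> first | rfl | (dsimp only; omega)
  have e2 : ∑ p ∈ U n, (T p.1 : ℤ) = ∑ p ∈ U n, (T p.2.2.1 : ℤ) := by
    refine Finset.sum_nbij' (fun p => ⟨p.2.2.1, (p.2.1, p.1, p.2.2.2.1, p.2.2.2.2)⟩)
      (fun p => ⟨p.2.2.1, (p.2.1, p.1, p.2.2.2.1, p.2.2.2.2)⟩) ?_ ?_ ?_ ?_ ?_ <;>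
    rintro ⟨x, a, b, c, d⟩ h <;> (try rw [mem_U] at *) <;> first | rfl | (dsimp only; omega)
  have e3 : ∑ p ∈ U n, (T p.1 : ℤ) = ∑ p ∈ U n, (T p.2.2.2.1 : ℤ) := by
    refine Finset.sum_nbij' (fun p => ⟨p.2.2.2.1, (p.2.1, p.2.2.1, p.1, p.2.2.2.2)⟩)
      (fun p => ⟨p.2.2.2.1, (p.2.1, p.2.2.1, p.1, p.2.2.2.2)⟩) ?_ ?_ ?_ ?_ ?_ <;>
    rintro ⟨x, a, b, c, d⟩ h <;> (try rw [mem_U] at *) <;> first | rfl | (dsimp only; omega)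
  have e4 : ∑ p ∈ U n, (T p.1 : ℤ) = ∑ p ∈ U n, (T p.2.2.2.2 : ℤ) := by
    refine Finset.sum_nbij' (fun p => ⟨p.2.2.2.2, (p.2.1, p.2.2.1, p.2.2.2.1, p.1)⟩)
      (fun p => ⟨p.2.2.2.2, (p.2.1, p.2.2.1, p.2.2.2.1, p.1)⟩) ?_ ?_ ?_ ?_ ?_ <;>
    rintro ⟨x, a, b, c, d⟩ h <;> (try rw [mem_U] at *) <;> first | rfl | (dsimp only; omega)
  have e5 : ∑ p ∈ U n, (n : ℤ) = ∑ p ∈ U n, ((T p.1 : ℤ) + T p.2.1 + T p.2.2.1 + T p.2.2.2.1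
      + T p.2.2.2.2) := by
    refine Finset.sum_congr rfl ?_
    rintro ⟨x, a, b, c, d⟩ h
    rw [mem_U] at h
    rw [← h]
    push_cast
    rfl
  rw [e, Finset.sum_sub_distrib, e5, ← Finset.mul_sum]
  simp only [Finset.sum_add_distrib]
  omega

lemma rec_sigma (n : ℕ) :
    ∑ x ∈ I n, ((n : ℤ) - 5 * T x) * (sigma' (2 * (n - T x) + 1) : ℤ) = 0 := by
  have e : ∑ x ∈ I n, ((n : ℤ) - 5 * T x) * (sigma' (2 * (n - T x) + 1) : ℤ) =
      ∑ p ∈ (I n).sigma (fun x => (2 * (n - T x) + 1).divisors),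
        ((n : ℤ) - 5 * T p.1) * (p.2 : ℤ) := by
    rw [Finset.sum_sigma]
    refine Finset.sum_congr rfl fun x _ => ?_
    rw [sigma', Nat.cast_sum, Finset.mul_sum]
  have hk := key n
  have hfl : ∑ p ∈ (S (8 * n + 5)).filter (fun p => ¬ 0 < p.1), (p.2.1 * p.2.2 - p.1 ^ 2) * p.2.1
      = ∑ p ∈ (S (8 * n + 5)).filter (fun p => 0 < p.1), (p.2.1 * p.2.2 - p.1 ^ 2) * p.2.1 := by
    refine Finset.sum_nbij' (fun p => (-p.1, p.2.1, p.2.2)) (fun p => (-p.1, p.2.1, p.2.2))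
      ?_ ?_ ?_ ?_ ?_
    · rintro ⟨x, y, z⟩ h
      rw [Finset.mem_filter, mem_S] at h ⊢
      obtain ⟨⟨h1, h2, h3⟩, h4⟩ := h
      have := odd_S h3
      dsimp only at *
      exact ⟨⟨h1, h2, by rw [neg_sq]; exact h3⟩, by omega⟩
    · rintro ⟨x, y, z⟩ h
      rw [Finset.mem_filter, mem_S] at h ⊢
      obtain ⟨⟨h1, h2, h3⟩, h4⟩ := h
      dsimp only at *
      exact ⟨⟨h1, h2, by rw [neg_sq]; exact h3⟩, by omega⟩
    · rintro ⟨x, y, z⟩ h; simp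
    · rintro ⟨x, y, z⟩ h; simp
    · rintro ⟨x, y, z⟩ h; simp
  rw [← Finset.sum_filter_add_sum_filter_not _ (fun p => 0 < p.1), hfl] at hk
  have e2 : ∑ p ∈ (I n).sigma (fun x => (2 * (n - T x) + 1).divisors),
        2 * (((n : ℤ) - 5 * T p.1) * (p.2 : ℤ)) =
      ∑ p ∈ (S (8 * n + 5)).filter (fun p => 0 < p.1), (p.2.1 * p.2.2 - p.1 ^ 2) * p.2.1 := by
    have hdiv : ∀ x d : ℕ, x ∈ I n → d ∈ (2 * (n - T x) + 1).divisors →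
        0 < d ∧ 0 < (2 * (n - T x) + 1) / d ∧
        (d : ℤ) * (((2 * (n - T x) + 1) / d : ℕ) : ℤ) = 2 * ((n : ℤ) - T x) + 1 := by
      intro x d hx hd
      rw [mem_I] at hx
      have hd' := Nat.dvd_of_mem_divisors hd
      refine ⟨Nat.pos_of_mem_divisors hd, Nat.div_pos (Nat.le_of_dvd (by omega) hd')
        (Nat.pos_of_mem_divisors hd), ?_⟩
      rw [← Nat.cast_mul, Nat.mul_div_cancel' hd']
      push_cast [hx]
      ring
    have hT : ∀ x : ℕ, 2 * (T x : ℤ) = x * (x + 1) := fun x => by exact_mod_cast two_T x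
    refine Finset.sum_nbij' (fun p => (2 * (p.1 : ℤ) + 1, (p.2 : ℤ),
        (((2 * (n - T p.1) + 1) / p.2 : ℕ) : ℤ)))
      (fun p => ⟨(p.1 / 2).toNat, p.2.1.toNat⟩) ?_ ?_ ?_ ?_ ?_
    · rintro ⟨x, d⟩ h
      rw [Finset.mem_sigma] at h
      obtain ⟨h1, h2, h3⟩ := hdiv x d h.1 h.2
      rw [Finset.mem_filter, mem_S]
      dsimp only
      refine ⟨⟨by exact_mod_cast h1, by exact_mod_cast h2, ?_⟩, by omega⟩
      rw [h3]
      linear_combination (-4) * hT x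
    · rintro ⟨x, y, z⟩ h
      rw [Finset.mem_filter, mem_S] at h
      obtain ⟨⟨h1, h2, h3⟩, h4⟩ := h
      have ho := odd_S h3
      dsimp only at *
      obtain ⟨k, rfl⟩ : ∃ k : ℕ, x = 2 * k + 1 := ⟨(x / 2).toNat, by omega⟩
      lift y to ℕ using h1.le
      lift z to ℕ using h2.le
      have e1 : ((2 * (k : ℤ) + 1) / 2).toNat = k := by omega
      rw [Finset.mem_sigma, e1, Int.toNat_natCast, mem_I, Nat.mem_divisors]
      have h5 : (y : ℤ) * z = 2 * ((n : ℤ) - T k) + 1 := by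
        have : 4 * ((y : ℤ) * z) = 4 * (2 * ((n : ℤ) - T k) + 1) := by
          linear_combination h3 + 4 * hT k
        linarith
      have h6 : (0 : ℤ) < y * z := mul_pos h1 h2
      have h7 : T k ≤ n := by omega
      refine ⟨h7, ⟨z, ?_⟩, by omega⟩
      zify [h7]
      exact h5.symm
    · rintro ⟨x, d⟩ h
      dsimp only
      have e1 : ((2 * (x : ℤ) + 1) / 2).toNat = x := by omega
      rw [e1, Int.toNat_natCast]
    · rintro ⟨x, y, z⟩ h
      rw [Finset.mem_filter, mem_S] at h
      obtain ⟨⟨h1, h2, h3⟩, h4⟩ := h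
      have ho := odd_S h3
      dsimp only at *
      obtain ⟨k, rfl⟩ : ∃ k : ℕ, x = 2 * k + 1 := ⟨(x / 2).toNat, by omega⟩
      lift y to ℕ using h1.le
      lift z to ℕ using h2.le
      have e1 : ((2 * (k : ℤ) + 1) / 2).toNat = k := by omega
      rw [e1, Int.toNat_natCast]
      have h5 : (y : ℤ) * z = 2 * ((n : ℤ) - T k) + 1 := by
        have : 4 * ((y : ℤ) * z) = 4 * (2 * ((n : ℤ) - T k) + 1) := by
          linear_combination h3 + 4 * hT k
        linarith
      have h6 : (0 : ℤ) < y * z := mul_pos h1 h2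
      have h7 : T k ≤ n := by omega
      have h8 : 2 * (n - T k) + 1 = y * z := by
        zify [h7]
        exact h5.symm
      rw [h8, Nat.mul_div_cancel_left z (by exact_mod_cast h1)]
    · rintro ⟨x, d⟩ h
      rw [Finset.mem_sigma] at h
      obtain ⟨h1, h2, h3⟩ := hdiv x d h.1 h.2
      dsimp only
      rw [h3]
      linear_combination (-4 * (d : ℤ)) * hT x
  rw [← Finset.mul_sum] at e2
  rw [e]
  omega

lemma T_zero : T 0 = 0 := rfl

lemma uniq (f g : ℕ → ℤ) (h0 : f 0 = g 0)
    (hf : ∀ n : ℕ, ∑ x ∈ I n, ((n : ℤ) - 5 * T x) * f (n - T x) = 0)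
    (hg : ∀ n : ℕ, ∑ x ∈ I n, ((n : ℤ) - 5 * T x) * g (n - T x) = 0) (n : ℕ) : f n = g n := by
  induction n using Nat.strong_induction_on with
  | _ n ih =>
    rcases Nat.eq_zero_or_pos n with rfl | hn
    · exact h0
    have hI : 0 ∈ I n := by rw [mem_I, T_zero]; omega
    have h1 := hf n
    have h2 := hg n
    rw [← Finset.add_sum_erase _ _ hI] at h1 h2
    have h3 : ∑ x ∈ (I n).erase 0, ((n : ℤ) - 5 * T x) * f (n - T x) =
        ∑ x ∈ (I n).erase 0, ((n : ℤ) - 5 * T x) * g (n - T x) := by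
      refine Finset.sum_congr rfl fun x hx => ?_
      have := Finset.ne_of_mem_erase hx
      have := le_T x
      rw [ih (n - T x) (by omega)]
    rw [h3] at h1
    simp only [T_zero, Nat.sub_zero, Nat.cast_zero, mul_zero, sub_zero] at h1 h2
    have h4 : (n : ℤ) * f n = n * g n := by linarith
    exact mul_left_cancel₀ (by exact_mod_cast hn.ne') h4

end LegT4

theorem legendre_t4 (n : ℕ) : t4 n = sigma' (2 * n + 1) := by
  have := LegT4.uniq (fun n => (t4 n : ℤ)) (fun n => (sigma' (2 * n + 1) : ℤ)) ?_
    LegT4.rec_t4 LegT4.rec_sigma n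
  · exact_mod_cast this
  · have h1 : t4 0 = 1 := by rw [LegT4.t4_eq]; decide
    have h2 : sigma' (2 * 0 + 1) = 1 := by decide
    simp only [h1, h2]
end
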